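/- The identities (A13) and (J5') form a 2-base for Boolean algebras: if a nonempty type B equipped with a binary operation ∧ and a unary operation ' satisfies (A13) (x ∧ y) ∧ z = (y ∧ z) ∧ x and (J5') x = (x' ∧ y)' ∧ (x' ∧ y')' for all x, y, z ∈ B, then there exists a Boolean algebra structure on B whose infimum operation is ∧ and whose complement operation is '. -/

import Mathlib

/-- If every element is a product, the cyclic law (A13) implies commutativity. -/
theorem comm_of_cyclic_of_factor {B : Type*} {m : B → B → B}
    (cyc : ∀ x y z, m (m x y) z = m (m y z) x) (factor : ∀ x, ∃ a b, x = m a b) (x y : B) :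
    m x y = m y x := by
  obtain ⟨a, b, rfl⟩ := factor x
  obtain ⟨c, y, rfl⟩ := factor y
  obtain ⟨d, y, rfl⟩ := factor y
  obtain ⟨e, f, rfl⟩ := factor y
  rw [← cyc (m c (m d (m e f))) a b, ← cyc a c (m d (m e f)), cyc (m a c) (m d (m e f)) b,
    ← cyc b d (m e f), cyc (m b d) (m e f) (m a c), ← cyc (m a c) e f, ← cyc e a c,
    ← cyc f (m e a) c, ← cyc (m b d) (m f (m e a)) c, ← cyc (m f (m e a)) b d,
    cyc f (m e a) b, cyc e a b, cyc (m a b) e f, ← cyc d (m e f) (m a b),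
    ← cyc c (m d (m e f)) (m a b)]

/-- A commutative semigroup operation `m` and a unary operation `c` satisfying Huntington's
equation. We read `m` as meet and `c` as complement. -/
structure IsHuntington {B : Type*} (m : B → B → B) (c : B → B) : Prop where
  comm : ∀ x y, m x y = m y x
  assoc : ∀ x y z, m (m x y) z = m x (m y z)
  huntington : ∀ x y, x = m (c (m (c x) y)) (c (m (c x) (c y)))

namespace IsHuntington

variable {B : Type*} {m : B → B → B} {c : B → B}

theorem inf_left_comm (h : IsHuntington m c) (x y z : B) : m x (m y z) = m y (m x z) := by
  rw [← h.assoc, h.comm x y, h.assoc]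

theorem inf_compl_eq_compl_inf_compl_compl (h : IsHuntington m c) (x : B) :
    m x (c x) = m (c x) (c (c x)) := by
  refine (congrArg₂ m (h.huntington x (c (c x))) (h.huntington (c x) (c (c x)))).trans
    (Eq.trans ?_ (congrArg₂ m (h.huntington (c x) (c x)) (h.huntington (c (c x)) (c x))).symm)
  simp only [h.comm, h.assoc, h.inf_left_comm]

theorem compl_compl (h : IsHuntington m c) (x : B) : c (c x) = x := by
  have h₁ := h.huntington (c (c x)) (c x)
  rw [h.comm (c (c (c x))) (c x), h.comm (c (c (c x))) (c (c x)),
    ← h.inf_compl_eq_compl_inf_compl_compl (c x), h.comm] at h₁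
  exact h₁.trans (h.huntington x (c (c x))).symm

theorem inf_compl_eq (h : IsHuntington m c) (x y : B) : m x (c x) = m y (c y) := by
  have expand (u v : B) : m u (c u) =
      m (m (c (m (c u) v)) (c (m (c u) (c v)))) (m (c (m u v)) (c (m u (c v)))) := by
    simpa only [h.compl_compl] using congrArg₂ m (h.huntington u v) (h.huntington (c u) v)
  rw [expand x y, expand y x]
  simp only [h.comm, h.assoc, h.inf_left_comm]

theorem top_inf (h : IsHuntington m c) (x y : B) : m (c (m x (c x))) y = y := by
  have expand (y : B) : y = m (c (m x (c x))) (c (m (c y) (c y))) := by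
    conv_lhs => rw [h.huntington y y]
    rw [h.comm (c y) y, h.inf_compl_eq y x]
  set b := m x (c x)
  have bot_eq : b = m (c b) b := by
    rw [h.comm]; exact h.inf_compl_eq x b
  have top_eq : c b = m (c b) (c (m b b)) := by
    simpa only [h.compl_compl] using expand (c b)
  have bot_inf : b = m b b := by
    have bot_eq' : b = m (c (m b b)) b := by
      calc b = m (c b) b := bot_eq
        _ = m (m (c b) (c (m b b))) b := by rw [← top_eq]
        _ = m (c (m b b)) (m (c b) b) := by rw [h.assoc, h.inf_left_comm]
        _ = m (c (m b b)) b := by rw [← bot_eq]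
    calc b = m (m b b) (c (m b b)) := h.inf_compl_eq x _
      _ = m b (m (c (m b b)) b) := by rw [h.assoc, h.comm b (c _)]
      _ = m b b := by rw [← bot_eq']
  have top_self : m (c b) (c b) = c b := by
    conv_rhs => rw [top_eq, ← bot_inf]
  calc m (c b) y = m (m (c b) (c b)) (c (m (c y) (c y))) := by rw [h.assoc, ← expand y]
    _ = y := by rw [top_self, ← expand y]

theorem inf_self (h : IsHuntington m c) (x : B) : m x x = x := by
  have h₁ := h.huntington (c x) (c x)
  rw [h.comm (c (c x)) (c x), h.top_inf, h.compl_compl] at h₁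
  rw [← h.compl_compl (m x x), ← h₁, h.compl_compl]

theorem inf_sup_self (h : IsHuntington m c) (x y : B) : m x (c (m (c x) (c y))) = x := by
  calc m x (c (m (c x) (c y)))
      = m (m (c (m (c x) y)) (c (m (c x) (c y)))) (c (m (c x) (c y))) := by
        rw [← h.huntington x y]
    _ = x := by rw [h.assoc, h.inf_self, ← h.huntington x y]

theorem inf_compl_inf (h : IsHuntington m c) (x y : B) : m (m x (c x)) y = m x (c x) := by
  have h₁ := h.inf_sup_self (m x (c x)) y
  rw [h.top_inf, h.compl_compl] at h₁
  exact h₁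

theorem inf_eq_left_iff (h : IsHuntington m c) (x y : B) :
    m x y = x ↔ m x (c y) = m x (c x) := by
  constructor
  · intro hxy
    rw [← hxy, h.assoc, h.comm x, h.inf_compl_eq y x, h.inf_compl_inf, hxy]
  · intro hxy
    have h₁ := h.huntington y x
    rw [h.comm (c y) x, hxy, h.top_inf, h.comm (c y)] at h₁
    rw [h₁]
    exact h.inf_sup_self x y

theorem compl_inf_compl_of_inf_eq_left (h : IsHuntington m c) {x y : B} (hxy : m x y = x) :
    m (c y) (c x) = c y := by
  rw [h.inf_eq_left_iff, h.compl_compl, h.compl_compl, h.comm, (h.inf_eq_left_iff x y).1 hxy,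
    h.comm (c y), h.inf_compl_eq]

theorem sup_inf_compl_inf (h : IsHuntington m c) (x y : B) :
    m (m (c (m (c x) (c y))) (c x)) y = m (c (m (c x) (c y))) (c x) := by
  rw [h.inf_eq_left_iff, h.assoc, h.comm (c (m (c x) (c y))), h.inf_compl_eq]

/-- Every model of Huntington's axioms is a Boolean algebra. -/
@[reducible] def toBooleanAlgebra (h : IsHuntington m c) (bot : B)
    (hbot : ∀ x, m x (c x) = bot) : BooleanAlgebra B where
  le x y := m x y = x
  le_refl := h.inf_self
  le_trans x y z hxy hyz := by
    rw [← hxy, h.assoc, hyz]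
  le_antisymm x y hxy hyx := by rw [← hxy, h.comm]; exact hyx
  inf := m
  inf_le_left x y := by
    rw [h.comm, ← h.assoc, h.inf_self]
  inf_le_right x y := by
    rw [h.assoc, h.inf_self]
  le_inf x y z hxy hxz := by
    rw [← h.assoc, hxy, hxz]
  sup x y := c (m (c x) (c y))
  le_sup_left := h.inf_sup_self
  le_sup_right x y := by
    rw [h.comm (c x)]
    exact h.inf_sup_self y x
  sup_le x y z hxz hyz := by
    have hz : m (c z) (m (c x) (c y)) = c z := by
      rw [← h.assoc, h.compl_inf_compl_of_inf_eq_left hxz, h.compl_inf_compl_of_inf_eq_left hyz]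
    simpa only [h.compl_compl] using h.compl_inf_compl_of_inf_eq_left hz
  le_sup_inf x y z := by
    change m (m (c (m (c x) (c y))) (c (m (c x) (c z)))) (c (m (c x) (c (m y z)))) =
      m (c (m (c x) (c y))) (c (m (c x) (c z)))
    set s := c (m (c x) (c y))
    set t := c (m (c x) (c z))
    have hy : m (m s (c x)) y = m s (c x) := h.sup_inf_compl_inf x y
    have hz : m (m t (c x)) z = m t (c x) := h.sup_inf_compl_inf x z
    have hle : m (m (m s t) (c x)) (m y z) = m (m s t) (c x) := by
      calc m (m (m s t) (c x)) (m y z) = m (m t (m (m s (c x)) y)) z := by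
            simp only [h.comm, h.assoc, h.inf_left_comm]
        _ = m s (m (m t (c x)) z) := by
            rw [hy]; simp only [h.comm, h.assoc, h.inf_left_comm]
        _ = m (m s t) (c x) := by rw [hz, h.assoc]
    rw [h.inf_eq_left_iff, h.compl_compl, ← h.assoc, (h.inf_eq_left_iff _ _).1 hle,
      h.inf_compl_eq]
  compl := c
  bot := bot
  top := c bot
  le_top x := by
    rw [h.comm, ← hbot x, h.top_inf]
  bot_le x := by
    rw [← hbot x, h.inf_compl_inf]
  inf_compl_le_bot x := by
    change m (m x (c x)) bot = m x (c x)
    rw [hbot, h.inf_self]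
  top_le_sup_compl x := by
    change m (c bot) (c (m (c x) (c (c x)))) = c bot
    rw [hbot, h.inf_self]

end IsHuntington

/-- (A13) and (J5') form a 2-base for Boolean algebras. -/
theorem A13_J5'_base {B : Type*} [Nonempty B] (m : B → B → B) (c : B → B)
    (A13 : ∀ x y z, m (m x y) z = m (m y z) x)
    (J5' : ∀ x y, x = m (c (m (c x) y)) (c (m (c x) (c y)))) :
    ∃ ba : BooleanAlgebra B, ba.inf = m ∧ ba.compl = c := by
  have comm := comm_of_cyclic_of_factor A13 fun x => ⟨_, _, J5' x x⟩
  have h : IsHuntington m c := ⟨comm, fun x y z => by rw [A13, comm], J5'⟩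
  obtain ⟨x₀⟩ := ‹Nonempty B›
  exact ⟨h.toBooleanAlgebra (m x₀ (c x₀)) fun x => h.inf_compl_eq x x₀, rfl, rfl⟩
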